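/- arXiv:2306.02846 — 8 statements merged into one kernel-verified Lean document; each statement's English description precedes it below -/
import Mathlib

section
/- Let u₁, u₂, v₁, v₂ be real numbers with 0 < u₁ < u₂, 0 < v₁ < v₂, and u₁/v₁ ≥ u₂/v₂. If x > 0 and y > 0 are real numbers with x/y ≥ u₁/v₁, then D(x,y) ≥ 0. -/
noncomputable def D (u₁ u₂ v₁ v₂ x y : ℝ) : ℝ :=
  ((u₁ + x) * Real.logb 2 ((u₁ + x) / (v₁ + y)) - u₁ * Real.logb 2 (u₁ / v₁)) -
    ((u₂ + x) * Real.logb 2 ((u₂ + x) / (v₂ + y)) - u₂ * Real.logb 2 (u₂ / v₂))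

lemma chord_aux (a b z : ℝ) (ha : 0 < a) (h1 : a ≤ z) (h2 : z ≤ b) (hab : a < b) :
    (b - a) * (z * Real.log z) ≤ (b - z) * (a * Real.log a) + (z - a) * (b * Real.log b) := by
  have hba : 0 < b - a := by linarith
  have h := Real.convexOn_mul_log.2 (show a ∈ Set.Ici (0:ℝ) from ha.le)
    (show b ∈ Set.Ici (0:ℝ) from (ha.trans hab).le)
    (show 0 ≤ (b - z) / (b - a) from div_nonneg (by linarith) hba.le)
    (show 0 ≤ (z - a) / (b - a) from div_nonneg (by linarith) hba.le)
    (by field_simp; ring)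
  simp only [smul_eq_mul] at h
  have e : (b - z) / (b - a) * a + (z - a) / (b - a) * b = z := by field_simp; ring
  rw [e] at h
  have h' := mul_le_mul_of_nonneg_left h hba.le
  refine h'.trans (le_of_eq ?_)
  field_simp

lemma mix_aux (a b c d p q r s : ℝ) (ha : 0 < a) (hr : 0 ≤ r) (hs : 0 ≤ s)
    (h1 : a ≤ c) (h2 : c ≤ b) (h3 : a ≤ d) (h4 : d ≤ b)
    (hm : p + q = r + s) (hM : p * a + q * b = r * c + s * d) :
    r * (c * Real.log c) + s * (d * Real.log d) ≤
      p * (a * Real.log a) + q * (b * Real.log b) := by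
  rcases (h1.trans h2).eq_or_lt with e | hab
  · subst e
    obtain rfl : c = a := le_antisymm h2 h1
    obtain rfl : d = c := le_antisymm h4 h3
    rw [← add_mul, ← add_mul, hm]
  · have k1 := mul_le_mul_of_nonneg_left (chord_aux a b c ha h1 h2 hab) hr
    have k2 := mul_le_mul_of_nonneg_left (chord_aux a b d ha h3 h4 hab) hs
    refine le_of_mul_le_mul_left ?_ (sub_pos.2 hab)
    generalize a * Real.log a = A at *
    generalize b * Real.log b = B at *
    generalize c * Real.log c = C at *
    generalize d * Real.log d = E at *
    have e : r * ((b - c) * A + (c - a) * B) + s * ((b - d) * A + (d - a) * B)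
        = (b - a) * (p * A + q * B) := by
      linear_combination (-(b * A) + a * B) * hm + (A - B) * hM
    linarith

theorem D_nonneg (u₁ u₂ v₁ v₂ x y : ℝ)
    (hu₁ : 0 < u₁) (hu : u₁ < u₂) (hv₁ : 0 < v₁) (hv : v₁ < v₂)
    (huv : u₁ / v₁ ≥ u₂ / v₂) (hx : 0 < x) (hy : 0 < y)
    (hxy : x / y ≥ u₁ / v₁) :
    D u₁ u₂ v₁ v₂ x y ≥ 0 := by
  have hu₂ : 0 < u₂ := hu₁.trans hu
  have hv₂ : 0 < v₂ := hv₁.trans hv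
  have p1 : 0 < v₁ + y := by linarith
  have p2 : 0 < v₂ + y := by linarith
  have hxy2 : u₂ / v₂ ≤ x / y := le_trans huv hxy
  rw [ge_iff_le, div_le_div_iff₀ (by assumption) (by assumption)] at huv hxy
  rw [div_le_div_iff₀ hv₂ hy] at hxy2
  have hd : (u₂ - u₁) * y ≤ x * (v₂ - v₁) := by
    have : (u₂ - u₁) * v₁ ≤ u₁ * (v₂ - v₁) := by linarith
    have h1 := mul_le_mul_of_nonneg_right this hy.le
    have h2 := mul_le_mul_of_nonneg_right hxy (sub_pos.2 hv).le
    refine le_of_mul_le_mul_left ?_ hv₁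
    linarith
  have key := mix_aux (u₂ / v₂) ((u₁ + x) / (v₁ + y)) (u₁ / v₁) ((u₂ + x) / (v₂ + y))
    v₂ (v₁ + y) v₁ (v₂ + y) (by positivity) hv₁.le p2.le
    (by rw [div_le_div_iff₀ hv₂ hv₁]; linarith)
    (by rw [div_le_div_iff₀ hv₁ p1]; linarith)
    (by rw [div_le_div_iff₀ hv₂ p2]; linarith)
    (by rw [div_le_div_iff₀ p2 p1]; linarith)
    (by ring) (by field_simp; ring)
  simp only [← mul_assoc, mul_div_cancel₀ _ hv₁.ne', mul_div_cancel₀ _ hv₂.ne',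
    mul_div_cancel₀ _ p1.ne', mul_div_cancel₀ _ p2.ne'] at key
  have e : D u₁ u₂ v₁ v₂ x y = (u₂ * Real.log (u₂ / v₂)
      + (u₁ + x) * Real.log ((u₁ + x) / (v₁ + y)) - (u₁ * Real.log (u₁ / v₁)
      + (u₂ + x) * Real.log ((u₂ + x) / (v₂ + y)))) / Real.log 2 := by
    unfold D Real.logb; ring
  rw [e]
  exact div_nonneg (by linarith) (Real.log_nonneg (by norm_num))
end

section
/- Fix integers N ≥ 2 and q with 1 ≤ q ≤ N−1. For each integer p with q ≤ p ≤ N−1, let J(p) be the smallest i ∈ {q, …, p} maximizing DP[i−1][q−1] + d_KL(i, p). If the score distribution is ideal, then J(p) ≤ J(p+1) for every p with q ≤ p ≤ N−2 (i.e., the matrix A of the dynamic-programming transition is a monotone matrix). -/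
noncomputable def dKL (g h : ℕ → ℝ) (il ir : ℕ) : ℝ :=
  (∑ i ∈ Finset.Icc il ir, g i) *
    Real.logb 2 ((∑ i ∈ Finset.Icc il ir, g i) / (∑ i ∈ Finset.Icc il ir, h i))

/-- `DP g h p q` is the maximum, over all integer sequences
`0 = i₀ < i₁ < … < i_q = p`, of `∑_{r=1}^{q} d_KL(i_{r−1}+1, i_r)`
(expressed as a supremum; the set is a finite nonempty set of reals for `1 ≤ q ≤ p`,
and `DP 0 0 = 0` since the empty sum is `0`). -/
noncomputable def DP (g h : ℕ → ℝ) (p q : ℕ) : ℝ :=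
  sSup {s : ℝ | ∃ idx : ℕ → ℕ, idx 0 = 0 ∧ idx q = p ∧
    (∀ r < q, idx r < idx (r + 1)) ∧
    s = ∑ r ∈ Finset.Icc 1 q, dKL g h (idx (r - 1) + 1) (idx r)}

lemma chord_aux_s1 (r1 r2 : ℝ) (h0 : 0 < r1) (h12 : r1 ≤ r2) :
    ∃ α β : ℝ, r1 * Real.log r1 = α * r1 + β ∧ r2 * Real.log r2 = α * r2 + β ∧
      ∀ r, r1 ≤ r → r ≤ r2 → r * Real.log r ≤ α * r + β := by
  rcases h12.eq_or_lt with rfl | hlt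
  · refine ⟨0, r1 * Real.log r1, by ring, by ring, fun r ha hb => ?_⟩
    obtain rfl : r = r1 := le_antisymm hb ha
    linarith
  · have hd : 0 < r2 - r1 := sub_pos.2 hlt
    set α := (r2 * Real.log r2 - r1 * Real.log r1) / (r2 - r1) with hα
    have hm : α * (r2 - r1) = r2 * Real.log r2 - r1 * Real.log r1 :=
      div_mul_cancel₀ _ hd.ne'
    refine ⟨α, r1 * Real.log r1 - α * r1, by ring, by linarith, fun r ha hb => ?_⟩
    have hd' : r2 - r1 ≠ 0 := hd.ne'
    have ht : (r2 - r) / (r2 - r1) + (r - r1) / (r2 - r1) = 1 := by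
      field_simp; ring
    have hc := Real.convexOn_mul_log.2 (Set.mem_Ici.2 h0.le)
      (Set.mem_Ici.2 (h0.trans hlt).le)
      (div_nonneg (by linarith : 0 ≤ r2 - r) hd.le)
      (div_nonneg (by linarith : 0 ≤ r - r1) hd.le) ht
    simp only [smul_eq_mul] at hc
    have e1 : (r2 - r) / (r2 - r1) * r1 + (r - r1) / (r2 - r1) * r2 = r := by
      field_simp; ring
    rw [e1] at hc
    refine hc.trans (le_of_eq ?_)
    rw [hα]; field_simp; ring

lemma monge_aux (a A x X y Y : ℝ) (ha : 0 < a) (hA : 0 < A) (hx : 0 < x) (hX : 0 < X)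
    (hy : 0 < y) (hY : 0 < Y) (h1 : x * A ≤ a * X) (h2 : a * Y ≤ y * A) (h3 : x * Y ≤ y * X) :
    a * Real.log (a / A) + (x + a + y) * Real.log ((x + a + y) / (X + A + Y)) ≤
      (a + y) * Real.log ((a + y) / (A + Y)) + (x + a) * Real.log ((x + a) / (X + A)) := by
  have k1 : (x + a) / (X + A) ≤ a / A := by
    rw [div_le_div_iff₀ (by positivity) (by positivity)]; nlinarith
  have k2 : a / A ≤ (a + y) / (A + Y) := by
    rw [div_le_div_iff₀ (by positivity) (by positivity)]; nlinarith
  have k3 : (x + a) / (X + A) ≤ (x + a + y) / (X + A + Y) := by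
    rw [div_le_div_iff₀ (by positivity) (by positivity)]; nlinarith
  have k4 : (x + a + y) / (X + A + Y) ≤ (a + y) / (A + Y) := by
    rw [div_le_div_iff₀ (by positivity) (by positivity)]; nlinarith
  obtain ⟨α, β, e1, e2, hc⟩ := chord_aux_s1 _ _ (by positivity) (k1.trans k2)
  have c1 := hc _ k1 k2
  have c2 := hc _ k3 k4
  have key : ∀ u U l : ℝ, 0 < U → U * (u / U * l) = u * l := by
    intro u U l hU; field_simp
  have key2 : ∀ u U : ℝ, 0 < U → U * (α * (u / U) + β) = α * u + β * U := by
    intro u U hU; field_simp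
  have d1 := mul_le_mul_of_nonneg_left c1 hA.le
  have d2 := mul_le_mul_of_nonneg_left c2 (by positivity : 0 ≤ X + A + Y)
  have d3 := congrArg (fun t => (X + A) * t) e1
  have d4 := congrArg (fun t => (A + Y) * t) e2
  rw [key _ _ _ (by positivity), key2 _ _ (by positivity)] at d1 d2 d3 d4
  linarith

lemma ratio_aux (N : ℕ) (g h : ℕ → ℝ)
    (hh : ∀ i, 1 ≤ i → i ≤ N → 0 < h i)
    (ideal : ∀ i, 1 ≤ i → i + 1 ≤ N → g i / h i ≤ g (i + 1) / h (i + 1))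
    (k l : ℕ) (hk : 1 ≤ k) (hkl : k ≤ l) (hl : l ≤ N) : g k * h l ≤ g l * h k := by
  have : g k / h k ≤ g l / h l := by
    induction l, hkl using Nat.le_induction with
    | base => exact le_rfl
    | succ n hn ih => exact (ih (by omega)).trans (ideal n (by omega) hl)
  rwa [div_le_div_iff₀ (hh k hk (by omega)) (hh l (by omega) hl)] at this

lemma block_aux (g h : ℕ → ℝ) (s t : Finset ℕ)
    (H : ∀ k ∈ s, ∀ l ∈ t, g k * h l ≤ g l * h k) :
    (∑ k ∈ s, g k) * (∑ l ∈ t, h l) ≤ (∑ l ∈ t, g l) * (∑ k ∈ s, h k) := by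
  rw [Finset.sum_mul_sum, Finset.sum_mul_sum, Finset.sum_comm (s := t)]
  exact Finset.sum_le_sum fun k hk => Finset.sum_le_sum fun l hl => H k hk l hl

lemma split_aux (f : ℕ → ℝ) (i j p : ℕ) (hij : i < j) (hjp : j ≤ p) :
    ∑ k ∈ Finset.Icc i p, f k = ∑ k ∈ Finset.Ico i j, f k + ∑ k ∈ Finset.Icc j p, f k := by
  have e : ∀ m, Finset.Icc m p = Finset.Ico m (p + 1) := by
    intro m; ext; simp only [Finset.mem_Icc, Finset.mem_Ico]; omega
  rw [e, e, Finset.sum_Ico_consecutive f hij.le (by omega)]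

lemma dKL_monge (N : ℕ) (g h : ℕ → ℝ)
    (hg : ∀ i, 1 ≤ i → i ≤ N → 0 < g i) (hh : ∀ i, 1 ≤ i → i ≤ N → 0 < h i)
    (ideal : ∀ i, 1 ≤ i → i + 1 ≤ N → g i / h i ≤ g (i + 1) / h (i + 1))
    (i j p : ℕ) (hi : 1 ≤ i) (hij : i < j) (hjp : j ≤ p) (hp : p + 1 ≤ N) :
    dKL g h j p + dKL g h i (p + 1) ≤ dKL g h j (p + 1) + dKL g h i p := by
  have R := ratio_aux N g h hh ideal
  have pos : ∀ f : ℕ → ℝ, (∀ i, 1 ≤ i → i ≤ N → 0 < f i) →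
      0 < ∑ k ∈ Finset.Icc j p, f k ∧ 0 < ∑ k ∈ Finset.Ico i j, f k := by
    intro f hf
    constructor
    · refine Finset.sum_pos (fun k hk => ?_) ⟨j, by simp [hjp]⟩
      rw [Finset.mem_Icc] at hk; exact hf k (by omega) (by omega)
    · refine Finset.sum_pos (fun k hk => ?_) ⟨i, by simp [hij]⟩
      rw [Finset.mem_Ico] at hk; exact hf k (by omega) (by omega)
  have b1 := block_aux g h (Finset.Ico i j) (Finset.Icc j p) (fun k hk l hl => by
    rw [Finset.mem_Ico] at hk; rw [Finset.mem_Icc] at hl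
    exact R k l (by omega) (by omega) (by omega))
  have b2 := block_aux g h (Finset.Icc j p) {p + 1} (fun k hk l hl => by
    rw [Finset.mem_Icc] at hk; rw [Finset.mem_singleton] at hl
    exact R k l (by omega) (by omega) (by omega))
  have b3 := block_aux g h (Finset.Ico i j) {p + 1} (fun k hk l hl => by
    rw [Finset.mem_Ico] at hk; rw [Finset.mem_singleton] at hl
    exact R k l (by omega) (by omega) (by omega))
  rw [Finset.sum_singleton, Finset.sum_singleton] at b2 b3
  have M := monge_aux _ _ _ _ _ _ (pos g hg).1 (pos h hh).1 (pos g hg).2 (pos h hh).2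
    (hg (p + 1) (by omega) hp) (hh (p + 1) (by omega) hp) b1 b2 b3
  unfold dKL Real.logb
  rw [Finset.sum_Icc_succ_top (by omega : i ≤ p + 1) g, Finset.sum_Icc_succ_top (by omega : i ≤ p + 1) h,
    Finset.sum_Icc_succ_top (by omega : j ≤ p + 1) g, Finset.sum_Icc_succ_top (by omega : j ≤ p + 1) h,
    split_aux g i j p hij hjp, split_aux h i j p hij hjp]
  have L := div_le_div_of_nonneg_right M (Real.log_pos (by norm_num : (1:ℝ) < 2)).le
  simpa only [add_div, mul_div_assoc] using L

theorem monotone_matrix_of_ideal (N : ℕ) (hN : 2 ≤ N) (g h : ℕ → ℝ)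
    (hg : ∀ i, 1 ≤ i → i ≤ N → 0 < g i) (hh : ∀ i, 1 ≤ i → i ≤ N → 0 < h i)
    (ideal : ∀ i, 1 ≤ i → i + 1 ≤ N → g i / h i ≤ g (i + 1) / h (i + 1))
    (q : ℕ) (hq1 : 1 ≤ q) (hqN : q ≤ N - 1)
    (J : ℕ → ℕ)
    (hJ : ∀ p, q ≤ p → p ≤ N - 1 →
      IsLeast {i | i ∈ Finset.Icc q p ∧
        ∀ j ∈ Finset.Icc q p,
          DP g h (j - 1) (q - 1) + dKL g h j p ≤
            DP g h (i - 1) (q - 1) + dKL g h i p} (J p)) :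
    ∀ p, q ≤ p → p ≤ N - 2 → J p ≤ J (p + 1) := by
  intro p hqp hpN
  by_contra! hlt
  obtain ⟨⟨hb, hbm⟩, hbl⟩ := hJ p hqp (by omega)
  obtain ⟨⟨ha, ham⟩, -⟩ := hJ (p + 1) (by omega) (by omega)
  rw [Finset.mem_Icc] at ha hb
  have hM := dKL_monge N g h hg hh ideal (J (p + 1)) (J p) p (by omega) hlt hb.2 (by omega)
  have h1 := ham (J p) (Finset.mem_Icc.2 ⟨hb.1, by omega⟩)
  have hmem : J p ≤ J (p + 1) := hbl ⟨Finset.mem_Icc.2 ⟨ha.1, by omega⟩, fun j hj => by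
    have := hbm j hj
    linarith⟩
  omega
end

section
/- Let u₁, u₂, v₁, v₂ be real numbers with 0 < u₁ < u₂, 0 < v₁ < v₂, and u₁/v₁ ≥ u₂/v₂. For any real y > 0 and reals 0 < x ≤ x′ with x/y ≥ u₁/v₁, it holds that D(x,y) ≤ D(x′,y); that is, D is nondecreasing in its first argument on the region where x/y ≥ u₁/v₁. -/
theorem aux_hasDeriv (u w t : ℝ) (h : 0 < u + t) (hw : 0 < w) :
    HasDerivAt (fun s : ℝ => (u + s) * Real.logb 2 ((u + s) / w))
      ((Real.log ((u + t) / w) + 1) / Real.log 2) t := by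
  have h1 : HasDerivAt (fun s : ℝ => u + s) 1 t := by
    simpa using (hasDerivAt_id t).const_add u
  have h2 : HasDerivAt (fun s : ℝ => (u + s) / w) (1 / w) t := h1.div_const w
  have hne : (u + t) / w ≠ 0 := (div_pos h hw).ne'
  have h3 := h1.mul ((h2.log hne).div_const (Real.log 2))
  have hl : Real.log 2 ≠ 0 := (Real.log_pos (by norm_num)).ne'
  refine HasDerivAt.congr_deriv h3 ?_
  have := h.ne'
  have := hw.ne'
  field_simp

theorem D_mono_in_x (u₁ u₂ v₁ v₂ : ℝ)
    (hu₁ : 0 < u₁) (hu : u₁ < u₂) (hv₁ : 0 < v₁) (hv : v₁ < v₂)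
    (huv : u₁ / v₁ ≥ u₂ / v₂)
    (y : ℝ) (hy : 0 < y) (x x' : ℝ) (hx : 0 < x) (hxx' : x ≤ x')
    (hxy : x / y ≥ u₁ / v₁) :
    D u₁ u₂ v₁ v₂ x y ≤ D u₁ u₂ v₁ v₂ x' y := by
  have hv₂ : 0 < v₂ := hv₁.trans hv
  have hu₂ : 0 < u₂ := hu₁.trans hu
  rw [ge_iff_le, div_le_div_iff₀ hv₂ hv₁] at huv
  rw [ge_iff_le, div_le_div_iff₀ hv₁ hy] at hxy
  have hd : ∀ t, x ≤ t → HasDerivAt (fun s => D u₁ u₂ v₁ v₂ s y)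
      ((Real.log ((u₁ + t) / (v₁ + y)) + 1) / Real.log 2
        - (Real.log ((u₂ + t) / (v₂ + y)) + 1) / Real.log 2) t := by
    intro t ht
    exact ((aux_hasDeriv u₁ (v₁ + y) t (by linarith) (by linarith)).sub_const _).sub
      ((aux_hasDeriv u₂ (v₂ + y) t (by linarith) (by linarith)).sub_const _)
  have hm : MonotoneOn (fun s => D u₁ u₂ v₁ v₂ s y) (Set.Ici x) := by
    apply monotoneOn_of_deriv_nonneg (convex_Ici x)
    · exact fun t ht => (hd t ht).continuousAt.continuousWithinAt
    · intro t ht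
      exact (hd t (interior_subset ht)).differentiableAt.differentiableWithinAt
    · intro t ht
      have ht' : x ≤ t := interior_subset ht
      rw [(hd t ht').deriv, sub_nonneg]
      have hl : 0 < Real.log 2 := Real.log_pos (by norm_num)
      have hpos : 0 < (u₂ + t) / (v₂ + y) := div_pos (by linarith) (by linarith)
      have hle : (u₂ + t) / (v₂ + y) ≤ (u₁ + t) / (v₁ + y) := by
        rw [div_le_div_iff₀ (by linarith) (by linarith)]
        have a1 : u₁ * y * (v₂ - v₁) ≤ x * v₁ * (v₂ - v₁) :=
          mul_le_mul_of_nonneg_right hxy (by linarith)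
        have a2 : y * (v₁ * (u₂ - u₁)) ≤ y * (u₁ * (v₂ - v₁)) :=
          mul_le_mul_of_nonneg_left (by linarith) hy.le
        have a3 : y * (u₂ - u₁) ≤ x * (v₂ - v₁) := by
          apply le_of_mul_le_mul_left _ hv₁
          linarith
        have a4 : x * (v₂ - v₁) ≤ t * (v₂ - v₁) :=
          mul_le_mul_of_nonneg_right ht' (by linarith)
        linarith
      have := Real.log_le_log hpos hle
      gcongr
  exact hm (Set.mem_Ici.2 le_rfl) (Set.mem_Ici.2 hxx') hxx'
end

section
/- Let u₁, u₂, v₁, v₂ be real numbers with 0 < u₁ < u₂, 0 < v₁ < v₂, and u₁/v₁ ≥ u₂/v₂. For any real x > 0 and reals 0 < y ≤ y′ with x/y′ ≥ u₁/v₁, it holds that D(x,y′) ≤ D(x,y); that is, D is nonincreasing in its second argument on the region where x/y ≥ u₁/v₁. -/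
theorem D_antitone_in_y (u₁ u₂ v₁ v₂ : ℝ)
    (hu₁ : 0 < u₁) (hu : u₁ < u₂) (hv₁ : 0 < v₁) (hv : v₁ < v₂)
    (huv : u₁ / v₁ ≥ u₂ / v₂)
    (x : ℝ) (hx : 0 < x) (y y' : ℝ) (hy : 0 < y) (hyy' : y ≤ y')
    (hxy' : x / y' ≥ u₁ / v₁) :
    D u₁ u₂ v₁ v₂ x y' ≤ D u₁ u₂ v₁ v₂ x y := by
  have hy' : 0 < y' := lt_of_lt_of_le hy hyy'
  have hv₂ : 0 < v₂ := hv₁.trans hv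
  have hu₂ : 0 < u₂ := hu₁.trans hu
  have h1 : u₂ * v₁ ≤ u₁ * v₂ := by
    rwa [ge_iff_le, div_le_div_iff₀ hv₂ hv₁] at huv
  have h2 : u₁ * y' ≤ x * v₁ := by
    rwa [ge_iff_le, div_le_div_iff₀ hv₁ hy'] at hxy'
  have h3 : (u₂ - u₁) * y' ≤ x * (v₂ - v₁) := by
    have e1 : (u₂ - u₁) * v₁ * y' ≤ u₁ * (v₂ - v₁) * y' :=
      mul_le_mul_of_nonneg_right (by linarith) hy'.le
    have e2 : u₁ * y' * (v₂ - v₁) ≤ x * v₁ * (v₂ - v₁) :=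
      mul_le_mul_of_nonneg_right h2 (by linarith)
    have e3 : ((u₂ - u₁) * y') * v₁ ≤ (x * (v₂ - v₁)) * v₁ := by linarith
    exact le_of_mul_le_mul_right e3 hv₁
  have hd : ∀ t ∈ Set.Icc y y', HasDerivAt
      (fun t => (u₂ + x) * Real.log (v₂ + t) - (u₁ + x) * Real.log (v₁ + t))
      ((u₂ + x) * (1 / (v₂ + t)) - (u₁ + x) * (1 / (v₁ + t))) t := by
    intro t ht
    have ht0 : 0 < t := lt_of_lt_of_le hy ht.1
    have k : ∀ v : ℝ, 0 < v → HasDerivAt (fun t => Real.log (v + t)) (1 / (v + t)) t :=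
      fun v hv => ((hasDerivAt_id t).const_add v).log (by simp only [id]; positivity)
    exact ((k v₂ hv₂).const_mul _).sub ((k v₁ hv₁).const_mul _)
  have hanti : AntitoneOn
      (fun t => (u₂ + x) * Real.log (v₂ + t) - (u₁ + x) * Real.log (v₁ + t)) (Set.Icc y y') := by
    apply antitoneOn_of_deriv_nonpos (convex_Icc y y')
    · exact fun t ht => (hd t ht).continuousAt.continuousWithinAt
    · exact fun t ht => (hd t (interior_subset ht)).differentiableAt.differentiableWithinAt
    · intro t ht
      have ht := interior_subset ht
      have ht0 : 0 < t := lt_of_lt_of_le hy ht.1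
      rw [(hd t ht).deriv, sub_nonpos, mul_one_div, mul_one_div,
        div_le_div_iff₀ (by positivity) (by positivity)]
      have : (u₂ - u₁) * t ≤ (u₂ - u₁) * y' :=
        mul_le_mul_of_nonneg_left ht.2 (by linarith)
      linarith
  have key := hanti (Set.left_mem_Icc.2 hyy') (Set.right_mem_Icc.2 hyy') hyy'
  simp only at key
  have hl : 0 < Real.log 2 := Real.log_pos (by norm_num)
  have key2 := div_le_div_of_nonneg_right key hl.le
  unfold D
  rw [Real.logb_div (x := u₁ + x) (by positivity) (by positivity),
    Real.logb_div (x := u₂ + x) (by positivity) (by positivity),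
    Real.logb_div (x := u₁ + x) (by positivity) (by positivity),
    Real.logb_div (x := u₂ + x) (by positivity) (by positivity)]
  simp only [sub_div, mul_div_assoc] at key2
  simp only [Real.logb] 
  linarith
end

section
/- Let u₁, u₂, v₁, v₂ be real numbers with 0 < u₁ < u₂, 0 < v₁ < v₂, and u₁/v₁ ≥ u₂/v₂. For any reals x > 0 and y > 0 with x/y ≥ u₁/v₁, it holds that D(x,y) ≥ D((y/v₁)·u₁, (y/v₁)·v₁); that is, the value of D at (x,y) is at least its value at the point on the ray x/y = u₁/v₁ with the same second coordinate. -/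
theorem D_aux (a₀ b₀ d A B : ℝ) (ha : 0 < a₀) (hab : a₀ < b₀) (hd : 0 ≤ d) (hA : 0 < A) (hB : 0 < B)
    (h : b₀ * A ≤ a₀ * B) :
    a₀ * Real.log (a₀ / A) - b₀ * Real.log (b₀ / B) ≤
    (a₀ + d) * Real.log ((a₀ + d) / A) - (b₀ + d) * Real.log ((b₀ + d) / B) := by
  have hb : 0 < b₀ := ha.trans hab
  have ha' : 0 < a₀ + d := by linarith
  have hb' : 0 < b₀ + d := by linarith
  have h1 : Real.log b₀ + Real.log A ≤ Real.log a₀ + Real.log B := by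
    rw [← Real.log_mul hb.ne' hA.ne', ← Real.log_mul ha.ne' hB.ne']
    exact Real.log_le_log (by positivity) h
  have h2 := Real.log_le_sub_one_of_pos (x := ((b₀ + d) * a₀) / (b₀ * (a₀ + d))) (by positivity)
  have h3 := Real.log_le_sub_one_of_pos (x := (b₀ + d) / b₀) (by positivity)
  rw [Real.log_div (by positivity) (by positivity), Real.log_mul hb'.ne' ha.ne',
    Real.log_mul hb.ne' ha'.ne'] at h2
  rw [Real.log_div hb'.ne' hb.ne'] at h3
  rw [Real.log_div ha.ne' hA.ne', Real.log_div hb.ne' hB.ne', Real.log_div ha'.ne' hA.ne',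
    Real.log_div hb'.ne' hB.ne']
  have h4 := mul_le_mul_of_nonneg_left h2 ha'.le
  have h5 := mul_le_mul_of_nonneg_left h3 (sub_nonneg.2 hab.le)
  have h6 := mul_le_mul_of_nonneg_left h1 hd
  have h7 : (a₀ + d) * (((b₀ + d) * a₀) / (b₀ * (a₀ + d)) - 1) + (b₀ - a₀) * ((b₀ + d) / b₀ - 1) = 0 := by
    field_simp
    ring
  linarith

theorem D_ge_on_ray (u₁ u₂ v₁ v₂ x y : ℝ)
    (hu₁ : 0 < u₁) (hu : u₁ < u₂) (hv₁ : 0 < v₁) (hv : v₁ < v₂)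
    (huv : u₁ / v₁ ≥ u₂ / v₂) (hx : 0 < x) (hy : 0 < y)
    (hxy : x / y ≥ u₁ / v₁) :
    D u₁ u₂ v₁ v₂ x y ≥ D u₁ u₂ v₁ v₂ ((y / v₁) * u₁) ((y / v₁) * v₁) := by
  have hv₂ : 0 < v₂ := hv₁.trans hv
  have e : y / v₁ * v₁ = y := by field_simp
  rw [e]
  obtain ⟨t, ht⟩ : ∃ t, t = y / v₁ := ⟨_, rfl⟩
  have ht0 : 0 < t := by rw [ht]; positivity
  rw [← ht] at e ⊢
  have h1 : u₂ * v₁ ≤ u₁ * v₂ := by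
    rwa [ge_iff_le, div_le_div_iff₀ hv₂ hv₁] at huv
  have h2 : t * u₁ ≤ x := by
    rw [ge_iff_le, div_le_div_iff₀ hv₁ hy, ← e] at hxy
    nlinarith
  have h3 := D_aux (u₁ + t * u₁) (u₂ + t * u₁) (x - t * u₁) (v₁ + y) (v₂ + y) (by positivity)
    (by linarith) (by linarith) (by positivity) (by positivity) (by
      rw [← e]
      nlinarith [mul_le_mul_of_nonneg_left h1 ht0.le])
  have h4 : 0 < Real.log 2 := Real.log_pos (by norm_num)
  have e1 : u₁ + t * u₁ + (x - t * u₁) = u₁ + x := by ring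
  have e2 : u₂ + t * u₁ + (x - t * u₁) = u₂ + x := by ring
  rw [e1, e2] at h3
  have h5 := div_le_div_of_nonneg_right h3 h4.le
  simp only [sub_div, mul_div_assoc] at h5
  simp only [← mul_div_assoc] at h5
  unfold D Real.logb
  simp only [mul_div_assoc] at h5 ⊢
  linarith
end

section
/- Let u₁, u₂, v₁, v₂ be real numbers with 0 < u₁ < u₂, 0 < v₁ < v₂, and u₁/v₁ ≥ u₂/v₂. For every real z > 0, it holds that D(z·u₁, z·v₁) ≥ 0. -/
lemma aux_log (a b S : ℝ) (ha : 0 < a) (hb : 0 < b) (hS : 0 < S) :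
    a - S * b ≤ a * (Real.log (a / b) - Real.log S) := by
  have h := Real.one_sub_inv_le_log_of_pos (x := a / b / S) (by positivity)
  rw [Real.log_div (by positivity) (by positivity)] at h
  have h2 := mul_le_mul_of_nonneg_left h ha.le
  have h3 : a * (1 - (a / b / S)⁻¹) = a - S * b := by field_simp
  linarith

theorem D_nonneg_on_ray (u₁ u₂ v₁ v₂ : ℝ)
    (hu₁ : 0 < u₁) (hu : u₁ < u₂) (hv₁ : 0 < v₁) (hv : v₁ < v₂)
    (huv : u₁ / v₁ ≥ u₂ / v₂) :
    ∀ z : ℝ, 0 < z → D u₁ u₂ v₁ v₂ (z * u₁) (z * v₁) ≥ 0 := by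
  intro z hz
  have hu₂ : 0 < u₂ := hu₁.trans hu
  have hv₂ : 0 < v₂ := hv₁.trans hv
  have hS : 0 < (u₂ + z * u₁) / (v₂ + z * v₁) := by positivity
  have h1 := aux_log u₂ v₂ _ hu₂ hv₂ hS
  have h2 := aux_log (z * u₁) (z * v₁) _ (by positivity) (by positivity) hS
  have e1 : z * u₁ / (z * v₁) = u₁ / v₁ := by field_simp
  have e2 : (u₁ + z * u₁) / (v₁ + z * v₁) = u₁ / v₁ := by
    rw [div_eq_div_iff (by positivity) (by positivity)]; ring
  have e3 : (u₂ + z * u₁) / (v₂ + z * v₁) * v₂ + (u₂ + z * u₁) / (v₂ + z * v₁) * (z * v₁)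
      = u₂ + z * u₁ := by
    rw [← mul_add, div_mul_cancel₀]; positivity
  rw [e1] at h2
  have hl : 0 < Real.log 2 := Real.log_pos (by norm_num)
  unfold D
  rw [e2]
  simp only [Real.logb]
  have : 0 ≤ (z * u₁ * Real.log (u₁ / v₁) + u₂ * Real.log (u₂ / v₂)
      - (u₂ + z * u₁) * Real.log ((u₂ + z * u₁) / (v₂ + z * v₁))) / Real.log 2 := by
    apply div_nonneg _ hl.le
    linarith
  refine le_of_le_of_eq this ?_
  ring
end

section
/- If the score distribution is ideal, then for all integers a′, a, p with 1 ≤ a′ < a ≤ p ≤ N−1, it holds that d_KL(a, p+1) − d_KL(a, p) ≥ d_KL(a′, p+1) − d_KL(a′, p). -/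
lemma aux_grad (x y r : ℝ) (hx : 0 < x) (hy : 0 < y) (hr : 0 < r) :
    x * (Real.log r + 1) - y * r ≤ x * Real.log (x / y) := by
  have h1 := Real.log_le_sub_one_of_pos (show 0 < r * y / x by positivity)
  rw [Real.log_div (by positivity) (by positivity), Real.log_mul (by positivity) (by positivity)] at h1
  rw [Real.log_div (by positivity) (by positivity)]
  have h2 := mul_le_mul_of_nonneg_left h1 hx.le
  have h3 : x * (r * y / x - 1) = r * y - x := by field_simp
  rw [h3] at h2
  nlinarith

lemma aux_log_s8 (s t : ℝ) (hs : 0 < s) (ht : 0 < t) :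
    Real.log t - Real.log s ≤ (t - s) / s := by
  have h1 := Real.log_le_sub_one_of_pos (show 0 < t / s by positivity)
  rw [Real.log_div (by positivity) (by positivity)] at h1
  have : (t - s) / s = t / s - 1 := by field_simp
  linarith

lemma aux_eq (x y : ℝ) (hy : 0 < y) :
    x * Real.log (x / y) = x * (Real.log (x / y) + 1) - y * (x / y) := by
  have : y * (x / y) = x := by field_simp
  rw [this]; ring

lemma aux_core (a a' b b' c c' : ℝ) (ha : 0 < a) (ha' : 0 < a') (hb : 0 < b) (hb' : 0 < b')
    (hc : 0 < c) (hc' : 0 < c') (hab : a * b' ≤ b * a') (hbc : b * c' ≤ c * b') :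
    (a + b + c) * Real.log ((a + b + c) / (a' + b' + c')) + b * Real.log (b / b') ≤
      (b + c) * Real.log ((b + c) / (b' + c')) + (a + b) * Real.log ((a + b) / (a' + b')) := by
  have e1 := aux_eq (a + b + c) (a' + b' + c') (by positivity)
  have e2 := aux_eq b b' hb'
  have hR : 0 < (a + b + c) / (a' + b' + c') := by positivity
  have hr : 0 < b / b' := by positivity
  have har : a ≤ a' * (b / b') := by
    rw [← mul_div_assoc, le_div_iff₀ hb']; linarith
  have hcr : c' * (b / b') ≤ c := by
    rw [← mul_div_assoc, div_le_iff₀ hb']; linarith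
  set R := (a + b + c) / (a' + b' + c')
  set r := b / b'
  have l := aux_log_s8 r R hr hR
  have l' := aux_log_s8 R r hR hr
  have g1 := aux_grad (b + c) (b' + c') R (by positivity) (by positivity) hR
  have g2 := aux_grad (a + b) (a' + b') r (by positivity) (by positivity) hr
  have g3 := aux_grad (b + c) (b' + c') r (by positivity) (by positivity) hr
  have g4 := aux_grad (a + b) (a' + b') R (by positivity) (by positivity) hR
  rw [e1, e2]
  rcases le_total r R with hRr | hRr
  · have k : a * (Real.log R - Real.log r) ≤ a' * (R - r) := by
      have h0 : 0 ≤ (R - r) / r := div_nonneg (by linarith) hr.le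
      calc _ ≤ a * ((R - r) / r) := by gcongr
        _ ≤ (a' * r) * ((R - r) / r) := by gcongr
        _ = _ := by field_simp
    linarith
  · have k : c' * (r - R) ≤ c * (Real.log r - Real.log R) := by
      have h0 : 0 ≤ (r - R) / r := div_nonneg (by linarith) hr.le
      have l2 : (r - R) / r ≤ Real.log r - Real.log R := by
        have : (r - R) / r = - ((R - r) / r) := by ring
        linarith
      calc _ = (c' * r) * ((r - R) / r) := by field_simp
        _ ≤ c * ((r - R) / r) := by gcongr
        _ ≤ _ := by gcongr
    linarith

theorem dKL_quadrangle (N : ℕ) (hN : 1 ≤ N) (g h : ℕ → ℝ)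
    (hg : ∀ i, 1 ≤ i → i ≤ N → 0 < g i) (hh : ∀ i, 1 ≤ i → i ≤ N → 0 < h i)
    (ideal : ∀ i, 1 ≤ i → i + 1 ≤ N → g i / h i ≤ g (i + 1) / h (i + 1))
    (a' a p : ℕ) (ha' : 1 ≤ a') (ha'a : a' < a) (hap : a ≤ p) (hpN : p ≤ N - 1) :
    dKL g h a (p + 1) - dKL g h a p ≥ dKL g h a' (p + 1) - dKL g h a' p := by
  have mono : ∀ i j, 1 ≤ i → i ≤ j → j ≤ N → g i / h i ≤ g j / h j := by
    intro i j hi hij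
    induction j, hij using Nat.le_induction with
    | base => intro _; exact le_rfl
    | succ k hk ih => intro hN'; exact (ih (by omega)).trans (ideal k (by omega) hN')
  have cross : ∀ i j, 1 ≤ i → i ≤ j → j ≤ N → g i * h j ≤ g j * h i := by
    intro i j hi hij hj
    exact (div_le_div_iff₀ (hh i hi (by omega)) (hh j (by omega) hj)).1 (mono i j hi hij hj)
  have split : ∀ (f : ℕ → ℝ), ∑ i ∈ Finset.Icc a' p, f i =
      ∑ i ∈ Finset.Ico a' a, f i + ∑ i ∈ Finset.Icc a p, f i := by
    intro f
    have e : ∀ x, Finset.Icc x p = Finset.Ico x (p + 1) := by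
      intro x; ext y; simp only [Finset.mem_Icc, Finset.mem_Ico]; omega
    rw [e, e, Finset.sum_Ico_consecutive _ (by omega) (by omega)]
  have pos : ∀ (f : ℕ → ℝ), (∀ i, 1 ≤ i → i ≤ N → 0 < f i) →
      0 < ∑ i ∈ Finset.Ico a' a, f i ∧ 0 < ∑ i ∈ Finset.Icc a p, f i := by
    intro f hf
    constructor
    · apply Finset.sum_pos
      · intro i hi
        rw [Finset.mem_Ico] at hi
        exact hf i (by omega) (by omega)
      · exact ⟨a', by simp; omega⟩
    · apply Finset.sum_pos
      · intro i hi
        rw [Finset.mem_Icc] at hi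
        exact hf i (by omega) (by omega)
      · exact ⟨a, by simp; omega⟩
  have core := aux_core (∑ i ∈ Finset.Ico a' a, g i) (∑ i ∈ Finset.Ico a' a, h i)
    (∑ i ∈ Finset.Icc a p, g i) (∑ i ∈ Finset.Icc a p, h i) (g (p + 1)) (h (p + 1))
    (pos g hg).1 (pos h hh).1 (pos g hg).2 (pos h hh).2
    (hg _ (by omega) (by omega)) (hh _ (by omega) (by omega))
    (by
      rw [mul_comm (∑ i ∈ Finset.Icc a p, g i), Finset.sum_mul_sum, Finset.sum_mul_sum]
      apply Finset.sum_le_sum; intro i hi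
      apply Finset.sum_le_sum; intro j hj
      rw [Finset.mem_Ico] at hi
      rw [Finset.mem_Icc] at hj
      rw [mul_comm (h i)]
      exact cross i j (by omega) (by omega) (by omega))
    (by
      rw [Finset.sum_mul, Finset.mul_sum]
      apply Finset.sum_le_sum; intro i hi
      rw [Finset.mem_Icc] at hi
      exact cross i (p + 1) (by omega) (by omega) (by omega))
  have l2 : 0 < Real.log 2 := Real.log_pos (by norm_num)
  have d := div_le_div_of_nonneg_right core l2.le
  unfold dKL Real.logb
  rw [Finset.sum_Icc_succ_top (show a ≤ p + 1 by omega), Finset.sum_Icc_succ_top (show a ≤ p + 1 by omega),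
    Finset.sum_Icc_succ_top (show a' ≤ p + 1 by omega), Finset.sum_Icc_succ_top (show a' ≤ p + 1 by omega),
    split g, split h]
  simp only [add_div _ _ (Real.log 2), mul_div_assoc] at d
  linarith
end

section
/- Let M ≥ 2 be an integer, let w(i) be a real number for each integer 1 ≤ i ≤ M, and let d(i,p) be a real number for all integers 1 ≤ i ≤ p ≤ M. Assume the inverse quadrangle condition: for all integers 1 ≤ a′ < a ≤ p ≤ M−1, d(a, p+1) − d(a, p) ≥ d(a′, p+1) − d(a′, p). For each p with 1 ≤ p ≤ M, let J(p) be the smallest i ∈ {1, …, p} maximizing w(i) + d(i, p). Then J(p) ≤ J(p+1) for all 1 ≤ p ≤ M−1. -/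
theorem monotone_argmax_of_inverse_quadrangle (M : ℕ) (hM : 2 ≤ M)
    (w : ℕ → ℝ) (d : ℕ → ℕ → ℝ)
    (hquad : ∀ a' a p : ℕ, 1 ≤ a' → a' < a → a ≤ p → p ≤ M - 1 →
      d a (p + 1) - d a p ≥ d a' (p + 1) - d a' p)
    (J : ℕ → ℕ)
    (hJ : ∀ p, 1 ≤ p → p ≤ M →
      IsLeast {i | i ∈ Finset.Icc 1 p ∧
        ∀ j ∈ Finset.Icc 1 p, w j + d j p ≤ w i + d i p} (J p)) :
    ∀ p, 1 ≤ p → p ≤ M - 1 → J p ≤ J (p + 1) := by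
  intro p hp hpM
  by_contra hlt
  have hlt' : J (p + 1) < J p := not_le.mp hlt
  obtain ⟨⟨ha, hamax⟩, hleast⟩ := hJ p hp (by omega)
  obtain ⟨⟨hb, hbmax⟩, _⟩ := hJ (p + 1) (by omega) (by omega)
  rw [Finset.mem_Icc] at ha hb
  have h1 := hbmax (J p) (Finset.mem_Icc.mpr ⟨ha.1, by omega⟩)
  have h2 := hquad (J (p + 1)) (J p) p hb.1 hlt' ha.2 hpM
  refine hlt (hleast ⟨Finset.mem_Icc.mpr ⟨hb.1, by omega⟩, fun j hj => ?_⟩)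
  have h3 := hamax j hj
  linarith
end
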